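/- arXiv:2510.10134 — 15 statements merged into one kernel-verified Lean document; each statement's English description precedes it below -/
import Mathlib

section
/- Assume 0 ≤ β < β* and I > 0. Then P_F((μ_D−f_D)/(λ_F m e)) = −I·(1 − (β(1−α)r_F/λ_F)·(1 − (μ_D−f_D)/(m e λ_F (1−α) K_F))), and this value is negative. -/
/-- Assume `0 ≤ β < β*` and `I > 0`. Then
`P_F((μ_D−f_D)/(λ_F m e)) = −I·(1 − (β(1−α)r_F/λ_F)·(1 − (μ_D−f_D)/(m e λ_F (1−α) K_F)))`,
and this value is negative. -/
theorem stmt_2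
    (fD muD mD mW m rF KF α e lamF β I : ℝ)
    (hfD : 0 ≤ fD) (hfmu : fD < muD)
    (hmD : 0 < mD) (hmW : 0 < mW) (hm : m = mD / mW)
    (hrF : 0 < rF) (hKF : 0 < KF)
    (hα0 : 0 ≤ α) (hα1 : α < 1)
    (he0 : 0 < e) (he1 : e ≤ 1)
    (hlamF : 0 < lamF)
    (hβ0 : 0 ≤ β)
    (hβ : β < 4 * (muD - fD) / (m * e * rF * (1 - α) ^ 2 * KF))
    (hI : 0 < I)
    (P : ℝ → ℝ)
    (hP : ∀ X, P X =
      (e * rF / KF) * X ^ 2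
      - (e * (1 - α) * rF + (muD - fD) * rF / (lamF * m * KF)
          + I * β * rF / (lamF * KF)) * X
      + ((muD - fD) * (1 - α) * rF / (lamF * m)
          - I * (1 - (1 - α) * β * rF / lamF))) :
    P ((muD - fD) / (lamF * m * e))
        = -I * (1 - (β * (1 - α) * rF / lamF) *
            (1 - (muD - fD) / (m * e * lamF * (1 - α) * KF)))
    ∧ P ((muD - fD) / (lamF * m * e)) < 0 := by
  have hm0 : 0 < m := by rw [hm]; positivity
  have ha : 0 < 1 - α := by linarith
  have hd : 0 < muD - fD := by linarith
  clear hm hfD hfmu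
  generalize muD - fD = d at *
  generalize 1 - α = a at *
  have key : P (d / (lamF * m * e))
        = -I * (1 - (β * a * rF / lamF) *
            (1 - d / (m * e * lamF * a * KF))) := by
    rw [hP]
    field_simp
    ring
  refine ⟨key, ?_⟩
  rw [key]
  obtain ⟨c, hc⟩ : ∃ c, c = d / (m * e * a * KF) := ⟨_, rfl⟩
  have hc0 : 0 < c := by rw [hc]; positivity
  have hb : β * a * rF < 4 * c := by
    have h1 : 4 * c = 4 * d / (m * e * rF * a ^ 2 * KF) * (a * rF) := by
      rw [hc]; field_simp
    rw [h1, mul_assoc]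
    exact mul_lt_mul_of_pos_right hβ (by positivity)
  have hb0 : 0 ≤ β * a * rF := by positivity
  have h2 : d / (m * e * lamF * a * KF) = c / lamF := by
    rw [hc]; field_simp
  rw [h2]
  generalize β * a * rF = b at *
  have h3 : b * (lamF - c) < lamF ^ 2 := by
    rcases le_or_gt lamF c with h | h
    · have : b * (lamF - c) ≤ 0 := mul_nonpos_of_nonneg_of_nonpos hb0 (by linarith)
      have : 0 < lamF ^ 2 := by positivity
      linarith
    · have : b * (lamF - c) < 4 * c * (lamF - c) :=
        mul_lt_mul_of_pos_right hb (by linarith)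
      nlinarith [sq_nonneg (lamF - 2 * c)]
  have h4 : b / lamF * (1 - c / lamF) < 1 := by
    have : b / lamF * (1 - c / lamF) = b * (lamF - c) / lamF ^ 2 := by
      field_simp
    rw [this, div_lt_one (by positivity)]
    exact h3
  have := mul_pos hI (sub_pos.mpr h4)
  linarith
end

section
/- Assume I > 0. Then the discriminant Δ_F of P_F is strictly positive; consequently P_F has two distinct real roots F₁* < F₂*. -/
/-- Assume `I > 0`. Then the discriminant `Δ_F` of `P_F` is strictly
positive; consequently `P_F` has two distinct real roots `F₁* < F₂*`. -/
theorem stmt_4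
    (fD muD mD mW m rF KF α e lamF β I : ℝ)
    (hfD : 0 ≤ fD) (hfmu : fD < muD)
    (hmD : 0 < mD) (hmW : 0 < mW) (hm : m = mD / mW)
    (hrF : 0 < rF) (hKF : 0 < KF)
    (hα0 : 0 ≤ α) (hα1 : α < 1)
    (he0 : 0 < e) (he1 : e ≤ 1)
    (hlamF : 0 < lamF)
    (hβ0 : 0 ≤ β) (hI : 0 < I)
    (P : ℝ → ℝ)
    (hP : ∀ X, P X =
      (e * rF / KF) * X ^ 2
      - (e * (1 - α) * rF + (muD - fD) * rF / (lamF * m * KF)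
          + I * β * rF / (lamF * KF)) * X
      + ((muD - fD) * (1 - α) * rF / (lamF * m)
          - I * (1 - (1 - α) * β * rF / lamF)))
    (ΔF : ℝ)
    (hΔ : ΔF =
      (e * (1 - α) * rF + (muD - fD) * rF / (lamF * m * KF)
          + I * β * rF / (lamF * KF)) ^ 2
      - 4 * (e * rF / KF) *
        ((muD - fD) * (1 - α) * rF / (lamF * m)
          - I * (1 - (1 - α) * β * rF / lamF))) :
    0 < ΔF ∧ ∃ F₁ F₂ : ℝ, F₁ < F₂ ∧ P F₁ = 0 ∧ P F₂ = 0 := by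
  have hm0 : 0 < m := by rw [hm]; positivity
  have ha : 0 < e * rF / KF := by positivity
  have hpos : 0 < ΔF := by
    have h : ΔF = (e * (1 - α) * rF - (muD - fD) * rF / (lamF * m * KF)
          - I * β * rF / (lamF * KF)) ^ 2 + 4 * (e * rF / KF) * I := by
      rw [hΔ]
      field_simp
      ring
    rw [h]
    positivity
  refine ⟨hpos, ?_⟩
  generalize e * rF / KF = a at *
  generalize e * (1 - α) * rF + (muD - fD) * rF / (lamF * m * KF)
          + I * β * rF / (lamF * KF) = b at *
  generalize (muD - fD) * (1 - α) * rF / (lamF * m)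
          - I * (1 - (1 - α) * β * rF / lamF) = c at *
  have hs : 0 < Real.sqrt ΔF := Real.sqrt_pos.2 hpos
  have hs2 : Real.sqrt ΔF ^ 2 = b ^ 2 - 4 * a * c := by
    rw [Real.sq_sqrt hpos.le, hΔ]
  generalize Real.sqrt ΔF = s at *
  refine ⟨(b - s) / (2 * a), (b + s) / (2 * a), ?_, ?_, ?_⟩
  · apply div_lt_div_of_pos_right _ (by positivity)
    linarith
  · rw [hP]
    field_simp
    linear_combination hs2
  · rw [hP]
    field_simp
    linear_combination hs2
end

section
/- Assume 0 < β < β* and I > 0, and let F₁* ≤ F₂* denote the two real roots of P_F. Then (1−α)K_F − K_F λ_F/(β r_F) ≤ F₁* ≤ (1−α)K_F, F₂* ≥ (μ_D−f_D)/(λ_F m e), and F₁* > 0 if and only if (μ_D−f_D)(1−α)r_F/(λ_F m) > I·(1 − (1−α)β r_F/λ_F). -/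
theorem aux_roots (a k c s I x y : ℝ) (ha : 0 < a) (hk : 0 < k) (hc : 0 < c) (hs : 0 < s)
    (hI : 0 < I) (hsc : k ^ 2 < 4 * (s * c)) (hxy : x < y)
    (h : ∀ X, a * (X - k) * (X - c) - I * (1 - (k - X) / s) = a * (X - x) * (X - y)) :
    k - s ≤ x ∧ x ≤ k ∧ c ≤ y ∧ (0 < x ↔ I * (1 - k / s) < a * k * c) := by
  have hsum : 0 < s + c - k := by nlinarith [sq_nonneg (s - c)]
  have h1 : a * ((k - x) * (k - y)) < 0 := by
    have := h k
    simp at this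
    nlinarith
  have h1' : (k - x) * (k - y) < 0 := by
    by_contra hh
    push Not at hh
    nlinarith [mul_nonneg ha.le hh]
  have hxk : x < k := by
    by_contra hh
    push Not at hh
    nlinarith [mul_nonneg (sub_nonneg.2 hh) (sub_nonneg.2 (hh.trans hxy.le))]
  have hky : k < y := by
    by_contra hh
    push Not at hh
    nlinarith [mul_nonneg (sub_nonneg.2 hxk.le) (sub_nonneg.2 hh)]
  refine ⟨?_, hxk.le, ?_, ?_⟩
  · have h2 := h (k - s)
    have e1 : (k - (k - s)) / s = 1 := by
      rw [sub_sub_cancel]; exact div_self hs.ne'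
    rw [e1] at h2
    have h3 : 0 < a * s * (s + c - k) := by positivity
    by_contra hh
    have hlt : x < k - s := not_le.1 hh
    have : 0 < a * ((k - s - x) * (y - (k - s))) :=
      mul_pos ha (mul_pos (by linarith) (by linarith))
    nlinarith
  · by_contra hh
    have hyc : y < c := not_le.1 hh
    have h2 := h c
    have h3 : (k - c) / s ≤ 0 := div_nonpos_of_nonpos_of_nonneg (by linarith) hs.le
    have h4 : 0 < a * (c - x) * (c - y) :=
      mul_pos (mul_pos ha (by linarith)) (by linarith)
    nlinarith
  · have h2 := h 0
    simp only [sub_zero, zero_sub] at h2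
    have hy : 0 < a * y := mul_pos ha (hk.trans hky)
    have h3 : a * k * c - I * (1 - k / s) = (a * y) * x := by linarith
    rw [← sub_pos (a := a * k * c), h3]
    exact (mul_pos_iff_of_pos_left hy).symm

/-- Assume `0 < β < β*` and `I > 0`, and let `F₁* ≤ F₂*` denote the
two real roots of `P_F`. Then `(1−α)K_F − K_F λ_F/(β r_F) ≤ F₁* ≤ (1−α)K_F`,
`F₂* ≥ (μ_D−f_D)/(λ_F m e)`, and `F₁* > 0` iff
`(μ_D−f_D)(1−α)r_F/(λ_F m) > I·(1 − (1−α)β r_F/λ_F)`. -/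
theorem stmt_5
    (fD muD mD mW m rF KF α e lamF β I : ℝ)
    (hfD : 0 ≤ fD) (hfmu : fD < muD)
    (hmD : 0 < mD) (hmW : 0 < mW) (hm : m = mD / mW)
    (hrF : 0 < rF) (hKF : 0 < KF)
    (hα0 : 0 ≤ α) (hα1 : α < 1)
    (he0 : 0 < e) (he1 : e ≤ 1)
    (hlamF : 0 < lamF)
    (hβ0 : 0 < β)
    (hβ : β < 4 * (muD - fD) / (m * e * rF * (1 - α) ^ 2 * KF))
    (hI : 0 < I)
    (P : ℝ → ℝ)
    (hP : ∀ X, P X =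
      (e * rF / KF) * X ^ 2
      - (e * (1 - α) * rF + (muD - fD) * rF / (lamF * m * KF)
          + I * β * rF / (lamF * KF)) * X
      + ((muD - fD) * (1 - α) * rF / (lamF * m)
          - I * (1 - (1 - α) * β * rF / lamF)))
    (F₁ F₂ : ℝ) (hle : F₁ ≤ F₂) (hne : F₁ ≠ F₂)
    (hroot₁ : P F₁ = 0) (hroot₂ : P F₂ = 0) :
    (1 - α) * KF - KF * lamF / (β * rF) ≤ F₁
    ∧ F₁ ≤ (1 - α) * KF
    ∧ (muD - fD) / (lamF * m * e) ≤ F₂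
    ∧ (0 < F₁ ↔
        I * (1 - (1 - α) * β * rF / lamF)
          < (muD - fD) * (1 - α) * rF / (lamF * m)) := by
  have hm0 : 0 < m := hm ▸ div_pos hmD hmW
  have hd : 0 < muD - fD := sub_pos.2 hfmu
  have ha1 : 0 < 1 - α := sub_pos.2 hα1
  have hlt : F₁ < F₂ := lt_of_le_of_ne hle hne
  obtain ⟨d, hdd⟩ : ∃ d, d = muD - fD := ⟨_, rfl⟩
  obtain ⟨q, hq⟩ : ∃ q, q = 1 - α := ⟨_, rfl⟩
  rw [← hdd] at hd hβ
  rw [← hq] at ha1 hβ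
  simp only [← hdd, ← hq] at hP ⊢
  have key := aux_roots (e * rF / KF) (q * KF) (d / (lamF * m * e)) (KF * lamF / (β * rF)) I F₁ F₂
    (by positivity) (by positivity) (by positivity) (by positivity) hI
    (by
      rw [lt_div_iff₀ (by positivity)] at hβ
      have e1 : 4 * (KF * lamF / (β * rF) * (d / (lamF * m * e)))
          = 4 * d * KF / (β * rF * m * e) := by field_simp
      rw [e1, lt_div_iff₀ (by positivity)]
      nlinarith [mul_lt_mul_of_pos_left hβ hKF]) hlt
    (by
      intro X
      have e1 : e * rF / KF * (X - q * KF) * (X - d / (lamF * m * e))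
          - I * (1 - (q * KF - X) / (KF * lamF / (β * rF))) = P X := by
        rw [hP]; field_simp; ring
      rw [e1]
      rw [hP] at hroot₁ hroot₂ ⊢
      generalize e * rF / KF = A at *
      generalize e * q * rF + d * rF / (lamF * m * KF) + I * β * rF / (lamF * KF) = B at *
      generalize d * q * rF / (lamF * m) - I * (1 - q * β * rF / lamF) = C at *
      have hB : B = A * (F₁ + F₂) := by
        have : (F₂ - F₁) * (B - A * (F₁ + F₂)) = 0 := by linarith
        rcases mul_eq_zero.1 this with h | h <;> linarith
      subst hB
      linarith)
  obtain ⟨k1, k2, k3, k4⟩ := key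
  refine ⟨k1, k2, k3, ?_⟩
  rw [k4]
  have e1 : q * KF / (KF * lamF / (β * rF)) = q * β * rF / lamF := by field_simp
  have e2 : e * rF / KF * (q * KF) * (d / (lamF * m * e)) = d * q * rF / (lamF * m) := by
    field_simp
  rw [e1, e2]
end

section
/- Assume 0 ≤ β < β*, I = 0 and N₀ > 1. Let F* := (μ_D−f_D)/(λ_F m e) and H* := (1−α)r_F(1 − F*/((1−α)K_F)) / (m(λ_F − β(1−α)r_F + β r_F F*/K_F)). Then λ_F − β(1−α)r_F + β r_F F*/K_F > 0, H* > 0, 0 < F* < (1−α)K_F, and the point (H_D, F_W, H_W) = (H*, F*, m H*) is an equilibrium of system (★), i.e. all three right-hand sides of (★) vanish at this point. -/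
/-- Assume `0 ≤ β < β*`, `I = 0` and `N₀ > 1`. With
`F* := (μ_D−f_D)/(λ_F m e)` and
`H* := (1−α)r_F(1 − F*/((1−α)K_F)) / (m(λ_F − β(1−α)r_F + β r_F F*/K_F))`, one has
`λ_F − β(1−α)r_F + β r_F F*/K_F > 0`, `H* > 0`, `0 < F* < (1−α)K_F`, and
`(H*, F*, m H*)` is an equilibrium of system (★). -/
theorem stmt_6
    (fD muD mD mW m rF KF α e lamF β I : ℝ)
    (hfD : 0 ≤ fD) (hfmu : fD < muD)
    (hmD : 0 < mD) (hmW : 0 < mW) (hm : m = mD / mW)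
    (hrF : 0 < rF) (hKF : 0 < KF)
    (hα0 : 0 ≤ α) (hα1 : α < 1)
    (he0 : 0 < e) (he1 : e ≤ 1)
    (hlamF : 0 < lamF)
    (hβ0 : 0 ≤ β)
    (hβ : β < 4 * (muD - fD) / (m * e * rF * (1 - α) ^ 2 * KF))
    (hI : I = 0)
    (hN : 1 < m * e * lamF * (1 - α) * KF / (muD - fD))
    (Fs Hs : ℝ)
    (hFs : Fs = (muD - fD) / (lamF * m * e))
    (hHs : Hs = (1 - α) * rF * (1 - Fs / ((1 - α) * KF)) /
        (m * (lamF - β * (1 - α) * rF + β * rF * Fs / KF))) :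
    0 < lamF - β * (1 - α) * rF + β * rF * Fs / KF
    ∧ 0 < Hs
    ∧ 0 < Fs ∧ Fs < (1 - α) * KF
    ∧ I + e * lamF * (m * Hs) * Fs + (fD - muD) * Hs - mD * Hs + mW * (m * Hs) = 0
    ∧ rF * (1 - α) * (1 + β * (m * Hs)) * (1 - Fs / (KF * (1 - α))) * Fs
        - lamF * Fs * (m * Hs) = 0
    ∧ mD * Hs - mW * (m * Hs) = 0 := by
  have ha : 0 < 1 - α := by linarith
  have hmp : 0 < m := by rw [hm]; positivity
  have hd : 0 < muD - fD := by linarith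
  generalize hA : 1 - α = a at *
  have hFd : muD - fD = Fs * (lamF * m * e) := by
    rw [hFs]; field_simp
  have hF0 : 0 < Fs := by rw [hFs]; positivity
  have hFK : Fs < a * KF := by
    rw [lt_div_iff₀ hd, hFd] at hN
    have h1 : 0 < lamF * m * e := by positivity
    by_contra hc
    push Not at hc
    nlinarith [mul_le_mul_of_nonneg_right hc h1.le]
  have hmm : mW * m = mD := by rw [hm]; field_simp
  obtain ⟨x, hx⟩ : ∃ x, x = Fs / (a * KF) := ⟨_, rfl⟩
  have hFx : Fs = x * (a * KF) := by rw [hx]; field_simp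
  have hx0 : 0 < x := by rw [hx]; positivity
  have hx1 : x < 1 := by rw [hx, div_lt_one (by positivity)]; exact hFK
  have hb : β * (a * rF) < 4 * lamF * x := by
    rw [lt_div_iff₀ (by positivity), hFd, hFx] at hβ
    have h1 : 0 < m * e * (a * KF) := by positivity
    by_contra hc
    push Not at hc
    nlinarith [mul_le_mul_of_nonneg_right hc h1.le]
  have hE : lamF - β * a * rF + β * rF * Fs / KF = lamF - β * (a * rF) * (1 - x) := by
    rw [hFx]; field_simp; ring
  have hD : 0 < lamF - β * (a * rF) * (1 - x) := by
    nlinarith [mul_lt_mul_of_pos_right hb (sub_pos.2 hx1), mul_nonneg hlamF.le (sq_nonneg (2 * x - 1))]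
  rw [hE, ← hx] at hHs
  rw [hE, mul_comm KF a, ← hx]
  have hH : Hs * m * (lamF - β * (a * rF) * (1 - x)) = a * rF * (1 - x) := by
    rw [hHs]; generalize lamF - β * (a * rF) * (1 - x) = q at *
    field_simp
  have h1x : 0 < 1 - x := by linarith
  refine ⟨hD, by rw [hHs]; positivity, hF0, hFK, ?_, ?_, ?_⟩
  · linear_combination hI - Hs * hFd + Hs * hmm
  · linear_combination (-Fs) * hH
  · linear_combination (-Hs) * hmm
end

section
/- Assume 0 ≤ β < β*, I > 0 and N_I > 1. Let F* := ((1−α)K_F/2)(1 − √Δ_F/(e(1−α)r_F)) + (μ_D − f_D + I β m)/(2 λ_F m e) and H* := I/(μ_D − f_D − e λ_F m F*). Then 0 < F* < (1−α)K_F, μ_D − f_D − e λ_F m F* > 0, H* > 0, and the point (H_D, F_W, H_W) = (H*, F*, m H*) is an equilibrium of system (★), i.e. all three right-hand sides of (★) vanish at this point. -/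
set_option maxHeartbeats 2000000 in
/-- Assume `0 ≤ β < β*`, `I > 0` and `N_I > 1`. With
`F* := ((1−α)K_F/2)(1 − √Δ_F/(e(1−α)r_F)) + (μ_D−f_D+Iβm)/(2λ_F m e)` and
`H* := I/(μ_D − f_D − e λ_F m F*)`, one has `0 < F* < (1−α)K_F`,
`μ_D − f_D − e λ_F m F* > 0`, `H* > 0`, and `(H*, F*, m H*)` is an equilibrium
of system (★). -/
theorem stmt_7
    (fD muD mD mW m rF KF α e lamF β I : ℝ)
    (hfD : 0 ≤ fD) (hfmu : fD < muD)
    (hmD : 0 < mD) (hmW : 0 < mW) (hm : m = mD / mW)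
    (hrF : 0 < rF) (hKF : 0 < KF)
    (hα0 : 0 ≤ α) (hα1 : α < 1)
    (he0 : 0 < e) (he1 : e ≤ 1)
    (hlamF : 0 < lamF)
    (hβ0 : 0 ≤ β)
    (hβ : β < 4 * (muD - fD) / (m * e * rF * (1 - α) ^ 2 * KF))
    (hI : 0 < I)
    (hN : 1 < rF * (1 - α) * ((muD - fD) / (m * I) + β) / lamF)
    (ΔF : ℝ)
    (hΔ : ΔF =
      (e * (1 - α) * rF + (muD - fD) * rF / (lamF * m * KF)
          + I * β * rF / (lamF * KF)) ^ 2
      - 4 * (e * rF / KF) *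
        ((muD - fD) * (1 - α) * rF / (lamF * m)
          - I * (1 - (1 - α) * β * rF / lamF)))
    (Fs Hs : ℝ)
    (hFs : Fs = ((1 - α) * KF / 2) * (1 - Real.sqrt ΔF / (e * (1 - α) * rF))
        + (muD - fD + I * β * m) / (2 * lamF * m * e))
    (hHs : Hs = I / (muD - fD - e * lamF * m * Fs)) :
    0 < Fs ∧ Fs < (1 - α) * KF
    ∧ 0 < muD - fD - e * lamF * m * Fs
    ∧ 0 < Hs
    ∧ I + e * lamF * (m * Hs) * Fs + (fD - muD) * Hs - mD * Hs + mW * (m * Hs) = 0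
    ∧ rF * (1 - α) * (1 + β * (m * Hs)) * (1 - Fs / (KF * (1 - α))) * Fs
        - lamF * Fs * (m * Hs) = 0
    ∧ mD * Hs - mW * (m * Hs) = 0 := by
  have hmp : 0 < m := by rw [hm]; positivity
  have hmm : mD = mW * m := by rw [hm]; field_simp
  obtain ⟨a, ha⟩ : ∃ a, a = 1 - α := ⟨_, rfl⟩
  obtain ⟨d, hd⟩ : ∃ d, d = muD - fD := ⟨_, rfl⟩
  have hap : 0 < a := by linarith
  have hdp : 0 < d := by linarith
  have hfm : fD - muD = -d := by linarith
  rw [hfm]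
  simp only [← ha, ← hd] at *
  clear hfm
  obtain ⟨c, hc⟩ : ∃ c, c = e * lamF * m := ⟨_, rfl⟩
  have hcp : 0 < c := by rw [hc]; positivity
  obtain ⟨k, hk⟩ : ∃ k, k = a * KF := ⟨_, rfl⟩
  have hkp : 0 < k := by rw [hk]; positivity
  obtain ⟨b, hb⟩ : ∃ b, b = β * m * I := ⟨_, rfl⟩
  have hb0 : 0 ≤ b := by rw [hb]; positivity
  obtain ⟨G, hG⟩ : ∃ G, G = lamF * m * I * KF / rF := ⟨_, rfl⟩
  have hGp : 0 < G := by rw [hG]; positivity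
  obtain ⟨S, hS⟩ : ∃ S, S = lamF * m * KF * Real.sqrt ΔF / rF := ⟨_, rfl⟩
  have hS0 : 0 ≤ S := by rw [hS]; positivity
  have hΔ' : ΔF = (rF / (lamF * m * KF)) ^ 2 * ((d + b - c * k) ^ 2 + 4 * c * G) := by
    rw [hΔ, hb, hc, hk, hG]; field_simp; ring
  have hΔ0 : 0 ≤ ΔF := by rw [hΔ']; positivity
  have hS2 : S ^ 2 = (d + b - c * k) ^ 2 + 4 * c * G := by
    have h1 : S ^ 2 = (lamF * m * KF / rF) ^ 2 * (Real.sqrt ΔF) ^ 2 := by rw [hS]; ring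
    rw [h1, Real.sq_sqrt hΔ0, hΔ']; field_simp
  have hF : 2 * c * Fs = d + b + c * k - S := by
    rw [hFs, hc, hk, hb, hS]; field_simp; ring
  have hcG : 0 < c * G := mul_pos hcp hGp
  have hN' : G < (d + b) * k := by
    rw [lt_div_iff₀ hlamF] at hN
    have h2 : (d + b) * k - G = (m * I * KF / rF) * (rF * a * (d / (m * I) + β) - 1 * lamF) := by
      rw [hb, hk, hG]; field_simp
    have h3 : 0 < (m * I * KF / rF) * (rF * a * (d / (m * I) + β) - 1 * lamF) :=
      mul_pos (by positivity) (by linarith)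
    linarith
  have hbG : b * (c * k - d) < c * G := by
    rcases le_or_gt (c * k) d with h | h
    · linarith [mul_nonneg hb0 (sub_nonneg.2 h)]
    · rw [lt_div_iff₀ (by positivity)] at hβ
      have h4 : β * (m * e * rF * a ^ 2 * KF) * (c * k - d) < 4 * d * (c * k - d) :=
        mul_lt_mul_of_pos_right hβ (by linarith)
      have h5 : 4 * d * (c * k - d) ≤ (c * k) ^ 2 := by linarith [sq_nonneg (c * k - 2 * d)]
      have h6 : c * G - b * (c * k - d) = (I / (e * rF * a ^ 2 * KF)) *
          ((c * k) ^ 2 - β * (m * e * rF * a ^ 2 * KF) * (c * k - d)) := by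
        rw [hb, hk, hG, hc]; field_simp
      have h7 : 0 < (I / (e * rF * a ^ 2 * KF)) *
          ((c * k) ^ 2 - β * (m * e * rF * a ^ 2 * KF) * (c * k - d)) :=
        mul_pos (by positivity) (by linarith)
      linarith
  have s1 : S < d + b + c * k :=
    lt_of_pow_lt_pow_left₀ 2 (by positivity) (by
      linarith [mul_pos hcp (sub_pos.2 hN')])
  have s2 : d + b - c * k < S := lt_of_pow_lt_pow_left₀ 2 hS0 (by linarith)
  have s3 : b + c * k - d < S := lt_of_pow_lt_pow_left₀ 2 hS0 (by linarith)
  have p1 : 0 < Fs := by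
    by_contra h
    linarith [mul_nonneg hcp.le (sub_nonneg.2 (not_lt.1 h))]
  have p2 : Fs < k := by
    by_contra h
    linarith [mul_nonneg hcp.le (sub_nonneg.2 (not_lt.1 h))]
  have p3 : 0 < d - c * Fs := by linarith
  have hQ : (d + b - c * Fs) * (k - Fs) = G := by
    have hSe : S = d + b + c * k - 2 * c * Fs := by linarith
    rw [hSe] at hS2
    have : c * ((d + b - c * Fs) * (k - Fs) - G) = 0 := by linarith
    rcases mul_eq_zero.1 this with h | h
    · exact absurd h hcp.ne'
    · linarith
  rw [← hc] at hHs
  have hHI : Hs * (d - c * Fs) = I := by rw [hHs]; field_simp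
  have p4 : 0 < Hs := by rw [hHs]; positivity
  rw [← hk, ← hc]
  refine ⟨p1, p2, p3, p4, ?_, ?_, ?_⟩
  · rw [hmm, ← hHI, hc]; ring
  · have e1 : KF * a = k := by rw [hk]; ring
    rw [e1]
    have e2 : rF * G = lamF * m * I * KF := by rw [hG]; field_simp
    have e3 : (1 + β * (m * Hs)) * (d - c * Fs) = d + b - c * Fs := by
      rw [hb, ← hHI]; ring
    have e4 : (rF * a * (1 + β * (m * Hs)) * (1 - Fs / k) - lamF * (m * Hs)) * (k * (d - c * Fs)) = 0 := by
      have : (1 - Fs / k) * k = k - Fs := by field_simp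
      calc _ = rF * a * ((1 + β * (m * Hs)) * (d - c * Fs)) * ((1 - Fs / k) * k)
              - lamF * m * (Hs * (d - c * Fs)) * k := by ring
        _ = a * (rF * ((d + b - c * Fs) * (k - Fs))) - lamF * m * I * k := by
            rw [e3, this, hHI]; ring
        _ = 0 := by rw [hQ, e2, hk]; ring
    have e5 := (mul_eq_zero.1 e4).resolve_right (mul_pos hkp p3).ne'
    linear_combination Fs * e5
  · rw [hmm]; ring
end

section
/- Assume 0 ≤ β < β*, I = 0 and N₀ > 1, and let (H*, F*) be the coexistence equilibrium of the reduced system, with F* = (μ_D−f_D)/(λ_F m e) and H* = (1−α)r_F(1 − F*/((1−α)K_F)) / (m(λ_F − β(1−α)r_F + β r_F F*/K_F)). Then the 2×2 matrix J := [[0, e λ_F m H*/(1+m)], [m(−λ_F + β(1−α)r_F(1 − F*/((1−α)K_F)))·F*, −(1+β m H*) r_F F*/K_F]] has trace J < 0 and det J > 0. -/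
/-- Assume `0 ≤ β < β*`, `I = 0` and `N₀ > 1`, and let `(H*, F*)` be
the coexistence equilibrium of the reduced system. Then the Jacobian-type matrix
`J := [[0, e λ_F m H*/(1+m)], [m(−λ_F + β(1−α)r_F(1 − F*/((1−α)K_F)))·F*, −(1+β m H*) r_F F*/K_F]]`
has negative trace and positive determinant. -/
theorem stmt_8
    (fD muD mD mW m rF KF α e lamF β I : ℝ)
    (hfD : 0 ≤ fD) (hfmu : fD < muD)
    (hmD : 0 < mD) (hmW : 0 < mW) (hm : m = mD / mW)
    (hrF : 0 < rF) (hKF : 0 < KF)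
    (hα0 : 0 ≤ α) (hα1 : α < 1)
    (he0 : 0 < e) (he1 : e ≤ 1)
    (hlamF : 0 < lamF)
    (hβ0 : 0 ≤ β)
    (hβ : β < 4 * (muD - fD) / (m * e * rF * (1 - α) ^ 2 * KF))
    (hI : I = 0)
    (hN : 1 < m * e * lamF * (1 - α) * KF / (muD - fD))
    (Fs Hs : ℝ)
    (hFs : Fs = (muD - fD) / (lamF * m * e))
    (hHs : Hs = (1 - α) * rF * (1 - Fs / ((1 - α) * KF)) /
        (m * (lamF - β * (1 - α) * rF + β * rF * Fs / KF)))
    (J : Matrix (Fin 2) (Fin 2) ℝ)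
    (hJ : J = !![0, e * lamF * m * Hs / (1 + m);
        m * (-lamF + β * (1 - α) * rF * (1 - Fs / ((1 - α) * KF))) * Fs,
        -(1 + β * m * Hs) * rF * Fs / KF]) :
    J.trace < 0 ∧ 0 < J.det := by
  have hm0 : 0 < m := hm ▸ div_pos hmD hmW
  have ha : 0 < 1 - α := by linarith
  have hmu : 0 < muD - fD := by linarith
  have hF0 : 0 < Fs := by rw [hFs]; positivity
  have hmu2 : muD - fD = Fs * (lamF * m * e) := by rw [hFs]; field_simp
  obtain ⟨x, hx⟩ : ∃ x, x = Fs / ((1 - α) * KF) := ⟨_, rfl⟩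
  have hx0 : 0 < x := by rw [hx]; positivity
  have hFx : Fs = x * ((1 - α) * KF) := by rw [hx]; field_simp
  have hx1 : x < 1 := by
    rw [hx, div_lt_one (by positivity)]
    rw [lt_div_iff₀ hmu, hmu2] at hN
    have hp : 0 < lamF * m * e := by positivity
    by_contra h
    push Not at h
    nlinarith [mul_le_mul_of_nonneg_right h hp.le]
  have hb : β * (1 - α) * rF < 4 * lamF * x := by
    have h1 : 4 * (muD - fD) / (m * e * rF * (1 - α) ^ 2 * KF)
        = 4 * lamF * x / ((1 - α) * rF) := by
      rw [hmu2, hFx]; field_simp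
    rw [h1, lt_div_iff₀ (by positivity)] at hβ
    linarith
  have hD : 0 < lamF - β * (1 - α) * rF * (1 - x) := by
    have h2 := mul_lt_mul_of_pos_right hb (sub_pos.2 hx1)
    nlinarith [mul_nonneg hlamF.le (sq_nonneg (2 * x - 1))]
  have hDe : lamF - β * (1 - α) * rF + β * rF * Fs / KF
      = lamF - β * (1 - α) * rF * (1 - x) := by
    rw [hFx]; field_simp; ring
  have hx1' : 0 < 1 - x := sub_pos.2 hx1
  rw [← hx, hDe] at hHs
  rw [← hx] at hJ
  have hH : 0 < Hs := by rw [hHs]; positivity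
  subst hJ
  rw [Matrix.trace_fin_two_of, Matrix.det_fin_two_of]
  constructor
  · have : 0 < (1 + β * m * Hs) * rF * Fs / KF := by positivity
    have h3 : -(1 + β * m * Hs) * rF * Fs / KF = -((1 + β * m * Hs) * rF * Fs / KF) := by ring
    rw [h3]; linarith
  · have : 0 < e * lamF * m * Hs / (1 + m)
        * (m * (lamF - β * (1 - α) * rF * (1 - x)) * Fs) := by positivity
    linarith
end

section
/- Assume 0 ≤ β < β*, I > 0 and N_I > 1, and let (H*, F*) be the coexistence equilibrium of the reduced system, with F* = ((1−α)K_F/2)(1 − √Δ_F/(e(1−α)r_F)) + (μ_D − f_D + I β m)/(2 λ_F m e) and H* = I/(μ_D − f_D − e λ_F m F*). Then the 2×2 matrix J := [[−I/((1+m)H*), e λ_F m H*/(1+m)], [m(−λ_F + β(1−α)r_F(1 − F*/((1−α)K_F)))·F*, −(1+β m H*) r_F F*/K_F]] has trace J < 0 and det J > 0. -/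
lemma quad_aux (A B C x F : ℝ) (hA : 0 < A) (hx : A * x ^ 2 - B * x + C < 0)
    (hF : 2 * A * F = B - Real.sqrt (B ^ 2 - 4 * A * C)) :
    F < x ∧ A * F ^ 2 - B * F + C = 0 := by
  have h1 : (2 * A * x - B) ^ 2 < B ^ 2 - 4 * A * C := by nlinarith
  have h0 : 0 ≤ B ^ 2 - 4 * A * C := le_trans (sq_nonneg _) h1.le
  have hs := Real.sq_sqrt h0
  have h2 := Real.lt_sqrt_of_sq_lt (x := |2 * A * x - B|) (by rwa [sq_abs])
  have h3 := (abs_lt.mp h2).1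
  constructor
  · have : 2 * A * F < 2 * A * x := by linarith
    exact lt_of_mul_lt_mul_left this (by positivity)
  · have h4 : Real.sqrt (B ^ 2 - 4 * A * C) = B - 2 * A * F := by linarith
    rw [h4] at hs
    have : 4 * A * (A * F ^ 2 - B * F + C) = 0 := by linarith
    rcases mul_eq_zero.mp this with h | h
    · linarith
    · exact h

lemma quad_pos (A B C F : ℝ) (hA : 0 < A) (hB : 0 < B) (hC : 0 < C)
    (h : A * F ^ 2 - B * F + C = 0) : 0 < F := by
  by_contra hn
  have : 0 ≤ B * (-F) := mul_nonneg hB.le (by linarith)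
  nlinarith [mul_nonneg hA.le (sq_nonneg F)]

/-- Assume `0 ≤ β < β*`, `I > 0` and `N_I > 1`, and let `(H*, F*)` be
the coexistence equilibrium of the reduced system. Then the matrix
`J := [[−I/((1+m)H*), e λ_F m H*/(1+m)], [m(−λ_F + β(1−α)r_F(1 − F*/((1−α)K_F)))·F*, −(1+β m H*) r_F F*/K_F]]`
has negative trace and positive determinant. -/
theorem stmt_9
    (fD muD mD mW m rF KF α e lamF β I : ℝ)
    (hfD : 0 ≤ fD) (hfmu : fD < muD)
    (hmD : 0 < mD) (hmW : 0 < mW) (hm : m = mD / mW)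
    (hrF : 0 < rF) (hKF : 0 < KF)
    (hα0 : 0 ≤ α) (hα1 : α < 1)
    (he0 : 0 < e) (he1 : e ≤ 1)
    (hlamF : 0 < lamF)
    (hβ0 : 0 ≤ β)
    (hβ : β < 4 * (muD - fD) / (m * e * rF * (1 - α) ^ 2 * KF))
    (hI : 0 < I)
    (hN : 1 < rF * (1 - α) * ((muD - fD) / (m * I) + β) / lamF)
    (ΔF : ℝ)
    (hΔ : ΔF =
      (e * (1 - α) * rF + (muD - fD) * rF / (lamF * m * KF)
          + I * β * rF / (lamF * KF)) ^ 2
      - 4 * (e * rF / KF) *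
        ((muD - fD) * (1 - α) * rF / (lamF * m)
          - I * (1 - (1 - α) * β * rF / lamF)))
    (Fs Hs : ℝ)
    (hFs : Fs = ((1 - α) * KF / 2) * (1 - Real.sqrt ΔF / (e * (1 - α) * rF))
        + (muD - fD + I * β * m) / (2 * lamF * m * e))
    (hHs : Hs = I / (muD - fD - e * lamF * m * Fs))
    (J : Matrix (Fin 2) (Fin 2) ℝ)
    (hJ : J = !![-I / ((1 + m) * Hs), e * lamF * m * Hs / (1 + m);
        m * (-lamF + β * (1 - α) * rF * (1 - Fs / ((1 - α) * KF))) * Fs,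
        -(1 + β * m * Hs) * rF * Fs / KF]) :
    J.trace < 0 ∧ 0 < J.det := by
  have hmp : 0 < m := by rw [hm]; positivity
  clear hm
  obtain ⟨a, ha⟩ : ∃ a, a = 1 - α := ⟨_, rfl⟩
  obtain ⟨d, hd⟩ : ∃ d, d = muD - fD := ⟨_, rfl⟩
  have hap : 0 < a := by linarith
  have hdp : 0 < d := by linarith
  simp only [← ha, ← hd] at hβ hN hΔ hFs hHs hJ
  have hβ' : β * (m * e * rF * a ^ 2 * KF) < 4 * d := by
    rwa [lt_div_iff₀ (by positivity)] at hβ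
  have hN' : lamF * m * I < rF * a * (d + β * m * I) := by
    rw [lt_div_iff₀ hlamF] at hN
    have h1 : rF * a * (d + β * m * I) = (rF * a * (d / (m * I) + β)) * (m * I) := by
      field_simp
    rw [h1]
    nlinarith [mul_pos hmp hI]
  obtain ⟨A, hA⟩ : ∃ A, A = e * rF / KF := ⟨_, rfl⟩
  obtain ⟨B, hB⟩ : ∃ B, B = e * a * rF + d * rF / (lamF * m * KF)
          + I * β * rF / (lamF * KF) := ⟨_, rfl⟩
  obtain ⟨C, hC⟩ : ∃ C, C = d * a * rF / (lamF * m)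
          - I * (1 - a * β * rF / lamF) := ⟨_, rfl⟩
  have hAp : 0 < A := by rw [hA]; positivity
  have hBp : 0 < B := by rw [hB]; positivity
  have hCp : 0 < C := by
    have : C = (rF * a * (d + β * m * I) - lamF * m * I) / (lamF * m) := by
      rw [hC]; field_simp; ring
    rw [this]
    exact div_pos (by linarith) (by positivity)
  rw [← hA, ← hB, ← hC] at hΔ
  have hQ : ∀ x, A * x ^ 2 - B * x + C
      = (rF * (d - e * lamF * m * x + β * m * I) * (a - x / KF) - m * lamF * I) / (lamF * m) := by
    intro x
    rw [hA, hB, hC]; field_simp; ring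
  have hF2 : 2 * A * Fs = B - Real.sqrt (B ^ 2 - 4 * A * C) := by
    rw [← hΔ, hFs, hA, hB]; field_simp; ring
  have hx1 : A * (a * KF) ^ 2 - B * (a * KF) + C < 0 := by
    rw [hQ]
    apply div_neg_of_neg_of_pos _ (by positivity)
    have : a - a * KF / KF = 0 := by field_simp; ring
    rw [this]
    have : 0 < m * lamF * I := by positivity
    linarith
  have hx2 : A * (d / (e * lamF * m)) ^ 2 - B * (d / (e * lamF * m)) + C < 0 := by
    rw [hQ]
    apply div_neg_of_neg_of_pos _ (by positivity)
    have h1 : rF * (d - e * lamF * m * (d / (e * lamF * m)) + β * m * I)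
        * (a - d / (e * lamF * m) / KF) - m * lamF * I
        = - (I * (lamF ^ 2 * (e * KF * m) - rF * β * a * (e * KF * m) * lamF + rF * β * d))
          / (e * lamF * KF) := by
      field_simp; ring
    rw [h1]
    apply div_neg_of_neg_of_pos _ (by positivity)
    have : 0 < lamF ^ 2 * (e * KF * m) - rF * β * a * (e * KF * m) * lamF + rF * β * d := by
      rcases hβ0.eq_or_lt with h | h
      · rw [← h]
        have : 0 < lamF ^ 2 * (e * KF * m) := by positivity
        linarith
      · have h3 : 0 < rF * β * (4 * d - β * (m * e * rF * a ^ 2 * KF)) :=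
          mul_pos (by positivity) (by linarith)
        have h4 : 0 ≤ (e * KF * m) * (2 * lamF - rF * β * a) ^ 2 := by positivity
        nlinarith
    have := mul_pos hI this
    linarith
  obtain ⟨hFk, hroot⟩ := quad_aux A B C _ Fs hAp hx1 hF2
  obtain ⟨hFd, -⟩ := quad_aux A B C _ Fs hAp hx2 hF2
  have hFp := quad_pos A B C Fs hAp hBp hCp hroot
  rw [lt_div_iff₀ (by positivity)] at hFd
  have hD : 0 < d - e * lamF * m * Fs := by linarith
  have hHp : 0 < Hs := by rw [hHs]; positivity
  have hHD : Hs * (d - e * lamF * m * Fs) = I := by rw [hHs]; field_simp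
  have hg : 0 < a - Fs / KF := by
    have : Fs / KF < a := by rwa [div_lt_iff₀ hKF]
    linarith
  have heq : rF * (1 + β * m * Hs) * (a - Fs / KF) = m * lamF * Hs := by
    have h := hQ Fs
    rw [hroot] at h
    have h5 : rF * (d - e * lamF * m * Fs + β * m * I) * (a - Fs / KF) - m * lamF * I = 0 := by
      rcases div_eq_zero_iff.mp h.symm with h | h
      · exact h
      · exact absurd h (by positivity)
    have h6 : (d - e * lamF * m * Fs) *
        (rF * (1 + β * m * Hs) * (a - Fs / KF) - m * lamF * Hs) = 0 := by
      rw [← h5]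
      linear_combination (rF * β * m * (a - Fs / KF) - m * lamF) * hHD
    rcases mul_eq_zero.mp h6 with h | h
    · linarith
    · linarith
  have hoff : e * lamF * m * Hs / (1 + m) * (m * (-lamF + β * a * rF * (1 - Fs / (a * KF))) * Fs)
      = - (e * lamF * m / (1 + m) * Fs * (rF * (a - Fs / KF))) := by
    have h1 : a * (1 - Fs / (a * KF)) = a - Fs / KF := by field_simp
    linear_combination (e * lamF * m / (1 + m) * Fs) * heq
      + e * lamF * m * Hs / (1 + m) * m * Fs * β * rF * h1
  have p1 : 0 < I / ((1 + m) * Hs) := by positivity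
  have p2 : 0 < (1 + β * m * Hs) * rF * Fs / KF := by positivity
  have p3 : 0 < e * lamF * m / (1 + m) * Fs * (rF * (a - Fs / KF)) := by positivity
  rw [hJ, Matrix.trace_fin_two_of, Matrix.det_fin_two_of, hoff]
  have e1 : -I / ((1 + m) * Hs) = - (I / ((1 + m) * Hs)) := by ring
  have e2 : -(1 + β * m * Hs) * rF * Fs / KF = - ((1 + β * m * Hs) * rF * Fs / KF) := by ring
  rw [e1, e2]
  have p4 := mul_pos p1 p2
  constructor <;> linarith
end

section
/- Let φ(H_D, F_W) := 1/(H_D F_W) and let (f₁, f₂) be the right-hand side of the reduced system. Then for every H_D > 0 and F_W > 0, the sum of the partial derivative of φ·f₁ with respect to H_D and the partial derivative of φ·f₂ with respect to F_W equals −I/((1+m) F_W H_D²) − (1+β m H_D) r_F/(H_D K_F), which is strictly negative. -/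
/-- With `φ(H_D,F_W) := 1/(H_D F_W)` and `(f₁,f₂)` the right-hand
side of the reduced system, for every `H_D > 0` and `F_W > 0`,
`∂(φf₁)/∂H_D + ∂(φf₂)/∂F_W = −I/((1+m)F_W H_D²) − (1+βmH_D)r_F/(H_D K_F) < 0`. -/
theorem stmt_10
    (fD muD mD mW m rF KF α e lamF β I : ℝ)
    (hfD : 0 ≤ fD) (hfmu : fD < muD)
    (hmD : 0 < mD) (hmW : 0 < mW) (hm : m = mD / mW)
    (hrF : 0 < rF) (hKF : 0 < KF)
    (hα0 : 0 ≤ α) (hα1 : α < 1)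
    (he0 : 0 < e) (he1 : e ≤ 1)
    (hlamF : 0 < lamF)
    (hβ0 : 0 ≤ β) (hI : 0 ≤ I) :
    ∀ HD FW : ℝ, 0 < HD → 0 < FW →
      deriv (fun h : ℝ => (1 / (h * FW)) *
          (I / (1 + m) + ((fD - muD) / (1 + m)) * h
            + (e / (1 + m)) * m * lamF * FW * h)) HD
      + deriv (fun w : ℝ => (1 / (HD * w)) *
          ((1 - α) * (1 + β * m * HD) * rF * (1 - w / ((1 - α) * KF)) * w
            - m * lamF * w * HD)) FW
      = -I / ((1 + m) * FW * HD ^ 2) - (1 + β * m * HD) * rF / (HD * KF)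
    ∧ -I / ((1 + m) * FW * HD ^ 2) - (1 + β * m * HD) * rF / (HD * KF) < 0 := by
  intro HD FW hH hF
  have hmpos : 0 < m := by rw [hm]; positivity
  have h1m : (1 + m) ≠ 0 := by positivity
  have hα : (1 - α) ≠ 0 := by linarith
  have hH0 := hH.ne'
  have hF0 := hF.ne'
  have hK0 := hKF.ne'
  constructor
  · have d1 : HasDerivAt (fun h : ℝ => (1 / (h * FW)) *
          (I / (1 + m) + ((fD - muD) / (1 + m)) * h
            + (e / (1 + m)) * m * lamF * FW * h)) (-I / ((1 + m) * FW * HD ^ 2)) HD := by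
      have a : HasDerivAt (fun h : ℝ => I / ((1 + m) * FW) * h⁻¹
          + ((fD - muD) / (1 + m) + (e / (1 + m)) * m * lamF * FW) / FW)
          (I / ((1 + m) * FW) * (-(HD ^ 2)⁻¹)) HD :=
        ((hasDerivAt_inv hH0).const_mul _).add_const _
      have b := a.congr_of_eventuallyEq (f₁ := fun h : ℝ => (1 / (h * FW)) *
          (I / (1 + m) + ((fD - muD) / (1 + m)) * h
            + (e / (1 + m)) * m * lamF * FW * h)) (by
        filter_upwards [eventually_ne_nhds hH0] with h hh
        field_simp
        try ring)
      have c : -I / ((1 + m) * FW * HD ^ 2) = I / ((1 + m) * FW) * (-(HD ^ 2)⁻¹) := by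
        field_simp
      rw [c]
      exact b
    have d2 : HasDerivAt (fun w : ℝ => (1 / (HD * w)) *
          ((1 - α) * (1 + β * m * HD) * rF * (1 - w / ((1 - α) * KF)) * w
            - m * lamF * w * HD)) (-((1 + β * m * HD) * rF / (HD * KF))) FW := by
      have a : HasDerivAt (fun w : ℝ => (-((1 + β * m * HD) * rF / (HD * KF))) * w
          + ((1 - α) * (1 + β * m * HD) * rF / HD - m * lamF))
          ((-((1 + β * m * HD) * rF / (HD * KF))) * 1) FW :=
        ((hasDerivAt_id FW).const_mul _).add_const _
      rw [mul_one] at a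
      refine a.congr_of_eventuallyEq ?_
      filter_upwards [eventually_ne_nhds hF0] with w hw
      field_simp
      ring
    rw [d1.deriv, d2.deriv]
    ring
  · have p1 : 0 ≤ I / ((1 + m) * FW * HD ^ 2) := by positivity
    have p2 : 0 < (1 + β * m * HD) * rF / (HD * KF) := by positivity
    rw [neg_div]
    linarith
end

section
/- Consider the real 3×3 matrix A := [[f_D − μ_D − m_D, 0, −e λ_F K_F(1−α) − m_W], [0, −(1−α)r_F, −λ_F(1−α)K_F], [−m_D, 0, −m_W]]. Its characteristic polynomial equals (X + (1−α)r_F)·(X² − (f_D − μ_D − m_D − m_W)X + m_W(μ_D − f_D) − m_D e λ_F K_F(1−α)), and all (complex) eigenvalues of A have negative real part if and only if N₀ < 1. -/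
open Polynomial

/-- The Jacobian `A` of the competitive system at the fauna-only
equilibrium has characteristic polynomial
`(X + (1−α)r_F)(X² − (f_D−μ_D−m_D−m_W)X + m_W(μ_D−f_D) − m_D e λ_F K_F(1−α))`,
and all complex eigenvalues of `A` have negative real part iff `N₀ < 1`. -/
theorem stmt_11
    (fD muD mD mW m rF KF α e lamF : ℝ)
    (hfD : 0 ≤ fD) (hfmu : fD < muD)
    (hmD : 0 < mD) (hmW : 0 < mW) (hm : m = mD / mW)
    (hrF : 0 < rF) (hKF : 0 < KF)
    (hα0 : 0 ≤ α) (hα1 : α < 1)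
    (he0 : 0 < e) (he1 : e ≤ 1)
    (hlamF : 0 < lamF)
    (A : Matrix (Fin 3) (Fin 3) ℝ)
    (hA : A = !![fD - muD - mD, 0, -(e * lamF * KF * (1 - α)) - mW;
                 0, -((1 - α) * rF), -(lamF * (1 - α) * KF);
                 -mD, 0, -mW]) :
    A.charpoly = (X + C ((1 - α) * rF)) *
        (X ^ 2 - C (fD - muD - mD - mW) * X
          + C (mW * (muD - fD) - mD * e * lamF * KF * (1 - α)))
    ∧ ((∀ z : ℂ, (A.map (fun x : ℝ => (x : ℂ))).charpoly.IsRoot z → z.re < 0)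
        ↔ m * e * lamF * (1 - α) * KF / (muD - fD) < 1) := by
  have h1 : A.charpoly = (X + C ((1 - α) * rF)) *
        (X ^ 2 - C (fD - muD - mD - mW) * X
          + C (mW * (muD - fD) - mD * e * lamF * KF * (1 - α))) := by
    subst hA
    simp [Matrix.charpoly, Matrix.det_fin_three, Matrix.charmatrix_apply]
    ring
  refine ⟨h1, ?_⟩
  have h2 : (A.map (fun x : ℝ => (x : ℂ))).charpoly = A.charpoly.map Complex.ofRealHom := by
    rw [← Matrix.charpoly_map]; rfl
  rw [h2, h1]
  have hN : m * e * lamF * (1 - α) * KF / (muD - fD) < 1 ↔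
      0 < mW * (muD - fD) - mD * e * lamF * KF * (1 - α) := by
    have hk : m * e * lamF * (1 - α) * KF = (mD * e * lamF * KF * (1 - α)) / mW := by
      rw [hm]; ring
    rw [hk, div_div, div_lt_one (mul_pos hmW (sub_pos.2 hfmu)), sub_pos]
  rw [hN]
  have hb : 0 < muD - fD + mD + mW := by linarith
  have hb' : fD - muD - mD - mW = -(muD - fD + mD + mW) := by ring
  have hs : 0 < (1 - α) * rF := mul_pos (by linarith) hrF
  rw [hb']
  generalize mW * (muD - fD) - mD * e * lamF * KF * (1 - α) = c
  generalize muD - fD + mD + mW = b at hb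
  generalize (1 - α) * rF = s at hs
  have hroot : ∀ z : ℂ, (((X + C s) * (X ^ 2 - C (-b) * X + C c)).map Complex.ofRealHom).IsRoot z ↔
      (z + s = 0 ∨ z ^ 2 + b * z + c = 0) := by
    intro z
    simp [Polynomial.IsRoot.def]
  simp only [hroot]
  constructor
  · intro h
    by_contra! hc
    have hd : 0 ≤ b ^ 2 - 4 * c := by nlinarith
    have hq := Real.sq_sqrt hd
    have hge : b ≤ Real.sqrt (b ^ 2 - 4 * c) := Real.le_sqrt_of_sq_le (by linarith)
    have hx := h (((-b + Real.sqrt (b ^ 2 - 4 * c)) / 2 : ℝ) : ℂ) (Or.inr (by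
      norm_cast
      nlinarith))
    rw [Complex.ofReal_re] at hx
    linarith
  · rintro hc z (hz | hz)
    · have := congrArg Complex.re hz
      simp at this
      linarith
    · have hre := congrArg Complex.re hz
      have him := congrArg Complex.im hz
      simp [pow_two] at hre him
      by_contra! hx
      have hy : z.im * (2 * z.re + b) = 0 := by linarith
      rcases mul_eq_zero.1 hy with hy | hy
      · rw [hy] at hre
        nlinarith [mul_nonneg hx hx, mul_nonneg hb.le hx]
      · linarith
end

section
/- Assume I > 0. Consider the real 3×3 matrix A := [[f_D − μ_D − m_D, −e λ_F m I/(μ_D − f_D), −m_W], [0, r_F(1−α)(1 + β m I/(μ_D − f_D)) − λ_F m I/(μ_D − f_D), 0], [−m_D, 0, −m_W]]. Its characteristic polynomial equals (X − r_F(1−α)(1 + β m I/(μ_D − f_D)) + λ_F m I/(μ_D − f_D))·(X² − (f_D − μ_D − m_D − m_W)X + m_W(μ_D − f_D)), and all (complex) eigenvalues of A have negative real part if and only if N_I < 1. -/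
open Polynomial

/-- Assume `I > 0`. The Jacobian `A` of the competitive system at
the human-only equilibrium has characteristic polynomial
`(X − r_F(1−α)(1 + βmI/(μ_D−f_D)) + λ_F mI/(μ_D−f_D))(X² − (f_D−μ_D−m_D−m_W)X + m_W(μ_D−f_D))`,
and all complex eigenvalues of `A` have negative real part iff `N_I < 1`. -/
theorem stmt_12
    (fD muD mD mW m rF KF α e lamF β I : ℝ)
    (hfD : 0 ≤ fD) (hfmu : fD < muD)
    (hmD : 0 < mD) (hmW : 0 < mW) (hm : m = mD / mW)
    (hrF : 0 < rF) (hKF : 0 < KF)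
    (hα0 : 0 ≤ α) (hα1 : α < 1)
    (he0 : 0 < e) (he1 : e ≤ 1)
    (hlamF : 0 < lamF)
    (hβ0 : 0 ≤ β) (hI : 0 < I)
    (A : Matrix (Fin 3) (Fin 3) ℝ)
    (hA : A = !![fD - muD - mD, -(e * lamF * m * I / (muD - fD)), -mW;
                 0, rF * (1 - α) * (1 + β * m * I / (muD - fD))
                      - lamF * m * I / (muD - fD), 0;
                 -mD, 0, -mW]) :
    A.charpoly = (X - C (rF * (1 - α) * (1 + β * m * I / (muD - fD))
            - lamF * m * I / (muD - fD))) *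
        (X ^ 2 - C (fD - muD - mD - mW) * X + C (mW * (muD - fD)))
    ∧ ((∀ z : ℂ, (A.map (fun x : ℝ => (x : ℂ))).charpoly.IsRoot z → z.re < 0)
        ↔ rF * (1 - α) * ((muD - fD) / (m * I) + β) / lamF < 1) := by
  have hmpos : 0 < m := by rw [hm]; positivity
  have hd : 0 < muD - fD := by linarith
  have hmI : 0 < m * I := by positivity
  set b : ℝ := rF * (1 - α) * (1 + β * m * I / (muD - fD)) - lamF * m * I / (muD - fD) with hb
  have hchar : A.charpoly = (X - C b) *
        (X ^ 2 - C (fD - muD - mD - mW) * X + C (mW * (muD - fD))) := by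
    rw [hA, Matrix.charpoly, Matrix.det_fin_three]
    simp [Matrix.charmatrix_apply]
    ring
  have hbt : b < 0 ↔ rF * (1 - α) * ((muD - fD) / (m * I) + β) / lamF < 1 := by
    have h1 : b = (rF * (1 - α) * ((muD - fD) / (m * I) + β) / lamF - 1) *
        (lamF * (m * I) / (muD - fD)) := by
      rw [hb]
      field_simp
    have h2 : 0 < lamF * (m * I) / (muD - fD) := by positivity
    rw [h1]
    constructor
    · intro h
      by_contra hc
      push Not at hc
      have := mul_nonneg (sub_nonneg.2 hc) h2.le
      linarith
    · intro h
      exact mul_neg_of_neg_of_pos (by linarith) h2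
  refine ⟨hchar, ?_⟩
  rw [← hbt]
  have hmap : (A.map (fun x : ℝ => (x : ℂ))).charpoly = A.charpoly.map Complex.ofRealHom :=
    Matrix.charpoly_map A Complex.ofRealHom
  rw [hmap, hchar]
  have hroot : ∀ z : ℂ, (((X - C b) * (X ^ 2 - C (fD - muD - mD - mW) * X
      + C (mW * (muD - fD)))).map Complex.ofRealHom).IsRoot z ↔
      (z - (b : ℂ)) * (z ^ 2 - ((fD - muD - mD - mW : ℝ) : ℂ) * z
        + ((mW * (muD - fD) : ℝ) : ℂ)) = 0 := by
    intro z
    simp [IsRoot.def, -mul_eq_zero]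
  simp only [hroot]
  constructor
  · intro h
    simpa using h (b : ℂ) (by simp)
  · intro h z hz
    rcases mul_eq_zero.1 hz with hz | hz
    · rw [sub_eq_zero.1 hz]
      simpa using h
    · have hq : 0 < mW * (muD - fD) := by positivity
      have hp : fD - muD - mD - mW < 0 := by linarith
      generalize mW * (muD - fD) = q at hz hq
      generalize fD - muD - mD - mW = p at hz hp
      have hre := congrArg Complex.re hz
      have him := congrArg Complex.im hz
      simp [pow_two] at hre him
      by_contra hc
      push Not at hc
      have hy : z.im * (2 * z.re - p) = 0 := by linarith
      rcases mul_eq_zero.1 hy with hy | hy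
      · rw [hy] at hre
        nlinarith [mul_nonneg hc (neg_pos.2 hp).le, mul_self_nonneg z.re]
      · linarith
end

section
/- Assume 0 ≤ β < β*, I > 0 and N_I > 1, and let F*, H* be the coexistence equilibrium values, with F* = ((1−α)K_F/2)(1 − √Δ_F/(e(1−α)r_F)) + (μ_D − f_D + I β m)/(2 λ_F m e), H* = I/(μ_D − f_D − e λ_F m F*), and H_W* = m H*. Then the three Routh–Hurwitz coefficients a₂ := μ_D − f_D + m_D + m_W + r_F(1+β H_W*)F*/K_F, a₁ := (μ_D − f_D + m_D + m_W)·r_F(1+β H_W*)F*/K_F + e λ_F m_D·((μ_D−f_D)/(e λ_F m) − F*), and a₀ := m_D λ_F e r_F·(√Δ_F/(e r_F) − I β/(λ_F K_F e) + (β H_W*/K_F)·((μ_D−f_D)/(e λ_F m) − F*))·F* are all strictly positive. -/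
/-- Assume `0 ≤ β < β*`, `I > 0` and `N_I > 1`. With the
coexistence equilibrium values `F*`, `H*`, `H_W* = m H*`, the three
Routh–Hurwitz coefficients `a₂`, `a₁`, `a₀` are all strictly positive. -/
theorem stmt_13
    (fD muD mD mW m rF KF α e lamF β I : ℝ)
    (hfD : 0 ≤ fD) (hfmu : fD < muD)
    (hmD : 0 < mD) (hmW : 0 < mW) (hm : m = mD / mW)
    (hrF : 0 < rF) (hKF : 0 < KF)
    (hα0 : 0 ≤ α) (hα1 : α < 1)
    (he0 : 0 < e) (he1 : e ≤ 1)
    (hlamF : 0 < lamF)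
    (hβ0 : 0 ≤ β)
    (hβ : β < 4 * (muD - fD) / (m * e * rF * (1 - α) ^ 2 * KF))
    (hI : 0 < I)
    (hN : 1 < rF * (1 - α) * ((muD - fD) / (m * I) + β) / lamF)
    (ΔF : ℝ)
    (hΔ : ΔF =
      (e * (1 - α) * rF + (muD - fD) * rF / (lamF * m * KF)
          + I * β * rF / (lamF * KF)) ^ 2
      - 4 * (e * rF / KF) *
        ((muD - fD) * (1 - α) * rF / (lamF * m)
          - I * (1 - (1 - α) * β * rF / lamF)))
    (Fs Hs HWs : ℝ)
    (hFs : Fs = ((1 - α) * KF / 2) * (1 - Real.sqrt ΔF / (e * (1 - α) * rF))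
        + (muD - fD + I * β * m) / (2 * lamF * m * e))
    (hHs : Hs = I / (muD - fD - e * lamF * m * Fs))
    (hHWs : HWs = m * Hs)
    (a₂ a₁ a₀ : ℝ)
    (ha₂ : a₂ = muD - fD + mD + mW + rF * (1 + β * HWs) * Fs / KF)
    (ha₁ : a₁ = (muD - fD + mD + mW) * (rF * (1 + β * HWs) * Fs / KF)
        + e * lamF * mD * ((muD - fD) / (e * lamF * m) - Fs))
    (ha₀ : a₀ = mD * lamF * e * rF *
        (Real.sqrt ΔF / (e * rF) - I * β / (lamF * KF * e)
          + (β * HWs / KF) * ((muD - fD) / (e * lamF * m) - Fs)) * Fs) :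
    0 < a₂ ∧ 0 < a₁ ∧ 0 < a₀ := by
  have hm0 : 0 < m := by rw [hm]; positivity
  obtain ⟨d, hd⟩ : ∃ d, d = muD - fD := ⟨_, rfl⟩
  have hd0 : 0 < d := by rw [hd]; linarith
  obtain ⟨q, hq⟩ : ∃ q, q = 1 - α := ⟨_, rfl⟩
  have hq0 : 0 < q := by rw [hq]; linarith
  rw [← hd] at hβ hN hΔ hFs hHs ha₂ ha₁ ha₀
  rw [← hq] at hβ hN hΔ hFs
  obtain ⟨k, hk⟩ : ∃ k, k = q * KF := ⟨_, rfl⟩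
  obtain ⟨A, hA⟩ : ∃ A, A = d / (e * lamF * m) := ⟨_, rfl⟩
  obtain ⟨B, hB⟩ : ∃ B, B = I * β / (lamF * e) := ⟨_, rfl⟩
  obtain ⟨C, hC⟩ : ∃ C, C = I * KF / (e * rF) := ⟨_, rfl⟩
  obtain ⟨S, hS⟩ : ∃ S, S = Real.sqrt ΔF * (KF / (e * rF)) := ⟨_, rfl⟩
  have hk0 : 0 < k := by rw [hk]; positivity
  have hA0 : 0 < A := by rw [hA]; positivity
  have hB0 : 0 ≤ B := by rw [hB]; positivity
  have hC0 : 0 < C := by rw [hC]; positivity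
  have hS0 : 0 ≤ S := by rw [hS]; positivity
  have hD : ΔF = (e * rF / KF) ^ 2 * ((k - A - B) ^ 2 + 4 * C) := by
    rw [hΔ, hk, hA, hB, hC]; field_simp; ring
  have hD0 : 0 < ΔF := by rw [hD]; positivity
  have hsq : S ^ 2 = (k - A - B) ^ 2 + 4 * C := by
    rw [hS, mul_pow, Real.sq_sqrt hD0.le, hD]; field_simp
  have hF : Fs = (k + A + B - S) / 2 := by
    rw [hFs, hS, hk, hA, hB]; field_simp; ring
  have hN' : C < k * (A + B) := by
    have h1 : k * (A + B) = C * (rF * q * (d / (m * I) + β) / lamF) := by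
      rw [hk, hA, hB, hC]; field_simp
    rw [h1]; exact lt_mul_of_one_lt_right hC0 hN
  have hF0 : 0 < Fs := by
    have : S < k + A + B := by
      apply lt_of_pow_lt_pow_left₀ 2 (by positivity)
      rw [hsq]
      have h9 : (k + A + B) ^ 2 = (k - A - B) ^ 2 + 4 * (k * (A + B)) := by ring
      linarith only [h9, hN']
    rw [hF]; linarith
  have hFA : Fs < A := by
    have hBk : B * k ^ 2 < 4 * A * C := by
      have h1 : 4 * A * C = (4 * d / (m * e * rF * q ^ 2 * KF)) * (I * k ^ 2 / (lamF * e)) := by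
        rw [hk, hA, hC]; field_simp
      have h2 : B * k ^ 2 = β * (I * k ^ 2 / (lamF * e)) := by
        rw [hB]; field_simp
      rw [h1, h2]
      exact mul_lt_mul_of_pos_right hβ (by positivity)
    have hkey : B * (k - A) < C := by
      have h3 : B * (k - A) * (4 * A) ≤ B * k ^ 2 := by
        have h8 := mul_nonneg hB0 (sq_nonneg (k - 2 * A))
        have h9 : B * (k - 2 * A) ^ 2 = B * k ^ 2 - B * (k - A) * (4 * A) := by ring
        linarith only [h8, h9]
      have h4 : B * (k - A) * (4 * A) < C * (4 * A) := by linarith only [h3, hBk]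
      exact lt_of_mul_lt_mul_right h4 (by positivity)
    have : k + B - A < S := by
      apply lt_of_pow_lt_pow_left₀ 2 hS0
      rw [hsq]
      have h9 : (k + B - A) ^ 2 = (k - A - B) ^ 2 + 4 * (B * (k - A)) := by ring
      linarith only [h9, hkey]
    rw [hF]; linarith
  have hAF : 0 < A - Fs := by linarith
  have hden : d - e * lamF * m * Fs = e * lamF * m * (A - Fs) := by
    rw [hA]; field_simp
  have hHW : HWs = I / (e * lamF * (A - Fs)) := by
    rw [hHWs, hHs, hden]; field_simp
  have hHW0 : 0 < HWs := by rw [hHW]; positivity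
  rw [← hA] at ha₁ ha₀
  have hcan : β * HWs / KF * (A - Fs) = I * β / (lamF * KF * e) := by
    rw [hHW]; field_simp
  refine ⟨?_, ?_, ?_⟩
  · rw [ha₂]; positivity
  · rw [ha₁]; positivity
  · rw [ha₀, hcan, sub_add_cancel]
    have := Real.sqrt_pos.mpr hD0
    positivity
end

section
/- Assume 0 ≤ β < β* and I > 0. Then Δ_F > (I β r_F/(λ_F K_F))²; equivalently, √Δ_F/(e r_F) − I β/(λ_F K_F e) > 0. -/
/-- Assume `0 ≤ β < β*` and `I > 0`. Then
`Δ_F > (Iβr_F/(λ_F K_F))²`; equivalently, `√Δ_F/(e r_F) − Iβ/(λ_F K_F e) > 0`. -/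
theorem stmt_14
    (fD muD mD mW m rF KF α e lamF β I : ℝ)
    (hfD : 0 ≤ fD) (hfmu : fD < muD)
    (hmD : 0 < mD) (hmW : 0 < mW) (hm : m = mD / mW)
    (hrF : 0 < rF) (hKF : 0 < KF)
    (hα0 : 0 ≤ α) (hα1 : α < 1)
    (he0 : 0 < e) (he1 : e ≤ 1)
    (hlamF : 0 < lamF)
    (hβ0 : 0 ≤ β)
    (hβ : β < 4 * (muD - fD) / (m * e * rF * (1 - α) ^ 2 * KF))
    (hI : 0 < I)
    (ΔF : ℝ)
    (hΔ : ΔF =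
      (e * (1 - α) * rF + (muD - fD) * rF / (lamF * m * KF)
          + I * β * rF / (lamF * KF)) ^ 2
      - 4 * (e * rF / KF) *
        ((muD - fD) * (1 - α) * rF / (lamF * m)
          - I * (1 - (1 - α) * β * rF / lamF))) :
    (I * β * rF / (lamF * KF)) ^ 2 < ΔF
    ∧ 0 < Real.sqrt ΔF / (e * rF) - I * β / (lamF * KF * e) := by
  have hm0 : 0 < m := by rw [hm]; positivity
  have ha : 0 < 1 - α := by linarith
  have hd : 0 < muD - fD := by linarith
  have key : (I * β * rF / (lamF * KF)) ^ 2 < ΔF := by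
    obtain ⟨A, hA⟩ : ∃ A, A = e * (1 - α) * rF := ⟨_, rfl⟩
    obtain ⟨B, hB⟩ : ∃ B, B = (muD - fD) * rF / (lamF * m * KF) := ⟨_, rfl⟩
    obtain ⟨G, hG⟩ : ∃ G, G = β / lamF := ⟨_, rfl⟩
    obtain ⟨P, hP⟩ : ∃ P, P = I * rF / KF := ⟨_, rfl⟩
    have hA0 : 0 < A := by rw [hA]; positivity
    have hB0 : 0 < B := by rw [hB]; positivity
    have hG0 : 0 ≤ G := by rw [hG]; positivity
    have hP0 : 0 < P := by rw [hP]; positivity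
    have h1 : ΔF - (I * β * rF / (lamF * KF)) ^ 2
        = (A - B) ^ 2 + 2 * P * (2 * e - G * (A - B)) := by
      rw [hΔ, hA, hB, hG, hP]
      field_simp
      ring
    have h2 : G * A ^ 2 ≤ 4 * B * e := by
      have h3 : 4 * B * e = 4 * (muD - fD) / (m * e * rF * (1 - α) ^ 2 * KF) / lamF * A ^ 2 := by
        rw [hA, hB]
        field_simp
      rw [h3, hG]
      gcongr
    have h4 : G * (A - B) ≤ e := by
      rcases le_total A B with h | h
      · have := mul_nonneg hG0 (sub_nonneg.2 h)
        linarith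
      · have h5 := mul_le_mul_of_nonneg_right h2 (sub_nonneg.2 h)
        have h6 := mul_nonneg he0.le (sq_nonneg (A - 2 * B))
        have hA2 : 0 < A ^ 2 := by positivity
        refine le_of_mul_le_mul_right ?_ hA2
        linarith
    have h7 : 0 < P * (2 * e - G * (A - B)) := mul_pos hP0 (by linarith)
    linarith [sq_nonneg (A - B)]
  refine ⟨key, ?_⟩
  have h8 : I * β * rF / (lamF * KF) < Real.sqrt ΔF := Real.lt_sqrt_of_sq_lt key
  have h9 : I * β / (lamF * KF * e) = I * β * rF / (lamF * KF) / (e * rF) := by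
    field_simp
  rw [h9, sub_pos]
  gcongr
end

section
/- Assume β = 0 and I = 0, let F* := (μ_D−f_D)/(λ_F m e), and define Δ := (μ_D − f_D + m_D + m_W + r_F F*/K_F)·(μ_D − f_D + m_D + m_W) − m_D e λ_F·(K_F(1−α) − F*). Define the quadratic Q(X) := e m_D (1−α) K_F · X² − ((μ_D − f_D + m_D + m_W)² + (μ_D − f_D) m_W)·X − (r_F(μ_D − f_D)/(K_F m e))·(μ_D − f_D + m_D + m_W). Then Q has exactly one positive real root λ_F*, Q is negative on (0, λ_F*) and positive on (λ_F*, ∞), and Δ > 0 if and only if λ_F < λ_F*. -/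
theorem quad_aux_s15 (a b c : ℝ) (ha : 0 < a) (hb : 0 < b) (hc : 0 < c) :
    ∃ s d : ℝ, 0 < s ∧ 0 < d ∧ ∀ x, a * x ^ 2 - b * x - c = (x - s) * (a * x + d) := by
  have hD : 0 ≤ b ^ 2 + 4 * a * c := by positivity
  have hsq := Real.sq_sqrt hD
  have hlt : b < √(b ^ 2 + 4 * a * c) := by
    apply Real.lt_sqrt_of_sq_lt
    have : 0 < a * c := mul_pos ha hc
    linarith
  generalize √(b ^ 2 + 4 * a * c) = t at *
  refine ⟨(b + t) / (2 * a), (t - b) / 2, by apply div_pos <;> linarith, by linarith, ?_⟩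
  intro x
  field_simp
  linear_combination hsq

/-- With `β = 0`, `I = 0`, `F* := (μ_D−f_D)/(λ_F m e)`,
`Δ := (μ_D−f_D+m_D+m_W+r_F F*/K_F)(μ_D−f_D+m_D+m_W) − m_D e λ_F (K_F(1−α) − F*)`
and `Q(X) := e m_D (1−α) K_F X² − ((μ_D−f_D+m_D+m_W)² + (μ_D−f_D)m_W)X
  − (r_F(μ_D−f_D)/(K_F m e))(μ_D−f_D+m_D+m_W)`,
the quadratic `Q` has exactly one positive real root `λ_F*`, `Q` is negative on
`(0, λ_F*)` and positive on `(λ_F*, ∞)`, and `Δ > 0` iff `λ_F < λ_F*`. -/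
theorem stmt_15
    (fD muD mD mW m rF KF α e lamF : ℝ)
    (hfD : 0 ≤ fD) (hfmu : fD < muD)
    (hmD : 0 < mD) (hmW : 0 < mW) (hm : m = mD / mW)
    (hrF : 0 < rF) (hKF : 0 < KF)
    (hα0 : 0 ≤ α) (hα1 : α < 1)
    (he0 : 0 < e) (he1 : e ≤ 1)
    (hlamF : 0 < lamF)
    (Fs Δ : ℝ)
    (hFs : Fs = (muD - fD) / (lamF * m * e))
    (hΔ : Δ = (muD - fD + mD + mW + rF * Fs / KF) * (muD - fD + mD + mW)
        - mD * e * lamF * (KF * (1 - α) - Fs))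
    (Q : ℝ → ℝ)
    (hQ : ∀ X, Q X = e * mD * (1 - α) * KF * X ^ 2
        - ((muD - fD + mD + mW) ^ 2 + (muD - fD) * mW) * X
        - (rF * (muD - fD) / (KF * m * e)) * (muD - fD + mD + mW)) :
    ∃ lamFstar : ℝ, 0 < lamFstar ∧ Q lamFstar = 0
      ∧ (∀ x : ℝ, 0 < x → Q x = 0 → x = lamFstar)
      ∧ (∀ x : ℝ, 0 < x → x < lamFstar → Q x < 0)
      ∧ (∀ x : ℝ, lamFstar < x → 0 < Q x)
      ∧ (0 < Δ ↔ lamF < lamFstar) := by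
  have hd : 0 < muD - fD := by linarith
  have hα : 0 < 1 - α := by linarith
  have hmp : 0 < m := by rw [hm]; positivity
  have hmW' : mD = m * mW := by rw [hm]; field_simp
  have key : Δ * lamF = - Q lamF := by
    rw [hΔ, hQ, hFs, hmW']
    field_simp
    ring
  obtain ⟨s, d, hs, hd0, hf⟩ := quad_aux_s15 (e * mD * (1 - α) * KF)
    ((muD - fD + mD + mW) ^ 2 + (muD - fD) * mW)
    ((rF * (muD - fD) / (KF * m * e)) * (muD - fD + mD + mW))
    (by positivity) (by positivity) (by positivity)
  have ha : 0 < e * mD * (1 - α) * KF := by positivity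
  generalize e * mD * (1 - α) * KF = a at *
  have hQ' : ∀ x, Q x = (x - s) * (a * x + d) := fun x => by rw [hQ, hf]
  have hp : ∀ x, 0 < x → 0 < a * x + d := fun x hx => by positivity
  have hneg : ∀ x : ℝ, 0 < x → x < s → Q x < 0 := fun x hx h => by
    rw [hQ']; exact mul_neg_of_neg_of_pos (by linarith) (hp x hx)
  have hpos : ∀ x : ℝ, s < x → 0 < Q x := fun x h => by
    rw [hQ']; exact mul_pos (by linarith) (hp x (by linarith))
  have hz : Q s = 0 := by rw [hQ']; ring
  refine ⟨s, hs, hz, ?_, hneg, hpos, ?_⟩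
  · intro x hx h
    rcases lt_trichotomy x s with h1 | h1 | h1
    · linarith [hneg x hx h1]
    · exact h1
    · linarith [hpos x h1]
  · constructor
    · intro h
      have h2 := mul_pos h hlamF
      by_contra! h3
      rcases h3.eq_or_lt with h4 | h4
      · rw [← h4] at key h2; linarith
      · linarith [hpos _ h4]
    · intro h
      have h2 := hneg _ hlamF h
      have : 0 < Δ * lamF := by linarith
      exact pos_of_mul_pos_left this hlamF.le
end

section
/- Assume β > 0 and λ_F < (1−α)β r_F, and set f_W^max := −K_F(1−α − λ_F/(β r_F)), which is negative. Then for every h_W ≤ 0 and every f_W with f_W^max ≤ f_W < 0: r_F(1−α)(1 − β h_W)(1 + f_W/((1−α)K_F))·f_W + λ_F f_W h_W ≤ (λ_F/β)·f_W, and in particular this quantity is strictly negative; moreover, at f_W = f_W^max it equals exactly (λ_F/β)·f_W^max. -/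
/-- Assume `β > 0` and `λ_F < (1−α)βr_F`, and set
`f_W^max := −K_F(1−α − λ_F/(βr_F))`, which is negative. Then for every
`h_W ≤ 0` and every `f_W` with `f_W^max ≤ f_W < 0`:
`r_F(1−α)(1−βh_W)(1 + f_W/((1−α)K_F))f_W + λ_F f_W h_W ≤ (λ_F/β)f_W < 0`;
moreover at `f_W = f_W^max` the quantity equals exactly `(λ_F/β)f_W^max`. -/
theorem stmt_18
    (fD muD mD mW m rF KF α e lamF β : ℝ)
    (hfD : 0 ≤ fD) (hfmu : fD < muD)
    (hmD : 0 < mD) (hmW : 0 < mW) (hm : m = mD / mW)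
    (hrF : 0 < rF) (hKF : 0 < KF)
    (hα0 : 0 ≤ α) (hα1 : α < 1)
    (he0 : 0 < e) (he1 : e ≤ 1)
    (hlamF : 0 < lamF)
    (hβ0 : 0 < β)
    (hlt : lamF < (1 - α) * β * rF)
    (fWmax : ℝ)
    (hfWmax : fWmax = -(KF * (1 - α - lamF / (β * rF)))) :
    fWmax < 0
    ∧ (∀ hW fW : ℝ, hW ≤ 0 → fWmax ≤ fW → fW < 0 →
        rF * (1 - α) * (1 - β * hW) * (1 + fW / ((1 - α) * KF)) * fW
            + lamF * fW * hW ≤ (lamF / β) * fW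
        ∧ rF * (1 - α) * (1 - β * hW) * (1 + fW / ((1 - α) * KF)) * fW
            + lamF * fW * hW < 0)
    ∧ (∀ hW : ℝ, hW ≤ 0 →
        rF * (1 - α) * (1 - β * hW) * (1 + fWmax / ((1 - α) * KF)) * fWmax
            + lamF * fWmax * hW = (lamF / β) * fWmax) := by
  have h1α : 0 < 1 - α := by linarith
  have h1 : (1 - α) ≠ 0 := h1α.ne'
  have key : ∀ hW fW : ℝ,
      rF * (1 - α) * (1 - β * hW) * (1 + fW / ((1 - α) * KF)) * fW + lamF * fW * hW
        = (lamF / β) * fW + rF / KF * (1 - β * hW) * ((fW - fWmax) * fW) := by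
    intro hW fW
    rw [hfWmax]
    field_simp
    ring
  refine ⟨?_, ?_, ?_⟩
  · have h2 : lamF / (β * rF) < 1 - α := by
      rw [div_lt_iff₀ (by positivity)]
      linarith
    have h3 : 0 < KF * (1 - α - lamF / (β * rF)) := mul_pos hKF (by linarith)
    linarith
  · intro hW fW hh hf hn
    rw [key]
    have h4 : 0 ≤ rF / KF * (1 - β * hW) :=
      mul_nonneg (by positivity) (by nlinarith)
    have h5 : (fW - fWmax) * fW ≤ 0 :=
      mul_nonpos_of_nonneg_of_nonpos (by linarith) hn.le
    have h6 := mul_nonpos_of_nonneg_of_nonpos h4 h5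
    have h7 : lamF / β * fW < 0 := mul_neg_of_pos_of_neg (by positivity) hn
    constructor <;> linarith
  · intro hW _
    rw [key]
    ring
end

section
/- Fix m̃_D > 0, m̃_W > 0 and set m := m̃_D/m̃_W. Let F* > 0, H_W* ≥ 0 be real numbers with F* ≤ (μ_D − f_D)/(e λ_F m). For ε > 0 define a₂(ε) := μ_D − f_D + m̃_D/ε + (1+β H_W*) r_F F*/K_F + m̃_W/ε, a₁(ε) := (μ_D − f_D + m̃_D/ε + m̃_W/ε)·r_F(1+β H_W*)F*/K_F + ((μ_D−f_D)/(e λ_F m) − F*)·e λ_F·(m̃_D/ε), and a₀(ε) := e λ_F (m̃_D/ε) r_F·((μ_D−f_D)/(e λ_F m K_F) − 2F*/K_F + (1−α) + (β H_W*/K_F)·((μ_D−f_D)/(e λ_F m) − F*))·F*. Then a₂(ε)a₁(ε) − a₀(ε) is of the form C₂/ε² + C₁/ε + C₀ with C₂ > 0, and consequently there exists ε₀ > 0 such that a₂(ε)a₁(ε) − a₀(ε) > 0 for all ε ∈ (0, ε₀). -/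
/-- With fast migration rates `m̃_D/ε`, `m̃_W/ε` and
`m := m̃_D/m̃_W`, the Routh–Hurwitz quantity `a₂(ε)a₁(ε) − a₀(ε)` at the
coexistence equilibrium has the form `C₂/ε² + C₁/ε + C₀` with `C₂ > 0`, so there
exists `ε₀ > 0` with `a₂(ε)a₁(ε) − a₀(ε) > 0` for all `ε ∈ (0, ε₀)`. -/
theorem stmt_19
    (fD muD rF KF α e lamF β tmD tmW m : ℝ)
    (hfD : 0 ≤ fD) (hfmu : fD < muD)
    (hrF : 0 < rF) (hKF : 0 < KF)
    (hα0 : 0 ≤ α) (hα1 : α < 1)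
    (he0 : 0 < e) (he1 : e ≤ 1)
    (hlamF : 0 < lamF)
    (hβ0 : 0 ≤ β)
    (htmD : 0 < tmD) (htmW : 0 < tmW) (hm : m = tmD / tmW)
    (Fs HWs : ℝ) (hFs : 0 < Fs) (hHWs : 0 ≤ HWs)
    (hFsle : Fs ≤ (muD - fD) / (e * lamF * m))
    (a₂ a₁ a₀ : ℝ → ℝ)
    (ha₂ : ∀ ε : ℝ, a₂ ε = muD - fD + tmD / ε
        + (1 + β * HWs) * rF * Fs / KF + tmW / ε)
    (ha₁ : ∀ ε : ℝ, a₁ ε = (muD - fD + tmD / ε + tmW / ε)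
          * (rF * (1 + β * HWs) * Fs / KF)
        + ((muD - fD) / (e * lamF * m) - Fs) * e * lamF * (tmD / ε))
    (ha₀ : ∀ ε : ℝ, a₀ ε = e * lamF * (tmD / ε) * rF
        * ((muD - fD) / (e * lamF * m * KF) - 2 * Fs / KF + (1 - α)
            + (β * HWs / KF) * ((muD - fD) / (e * lamF * m) - Fs)) * Fs) :
    (∃ C₂ C₁ C₀ : ℝ, 0 < C₂
      ∧ (∀ ε : ℝ, 0 < ε →
          a₂ ε * a₁ ε - a₀ ε = C₂ / ε ^ 2 + C₁ / ε + C₀))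
    ∧ ∃ ε₀ : ℝ, 0 < ε₀ ∧ ∀ ε : ℝ, 0 < ε → ε < ε₀ →
        0 < a₂ ε * a₁ ε - a₀ ε := by
  have hd : 0 < muD - fD := by linarith
  have hR : 0 < rF * (1 + β * HWs) * Fs / KF := by positivity
  have hQ : 0 ≤ ((muD - fD) / (e * lamF * m) - Fs) * e * lamF * tmD := by
    have : 0 ≤ (muD - fD) / (e * lamF * m) - Fs := by linarith
    positivity
  have hR2 : (1 + β * HWs) * rF * Fs / KF = rF * (1 + β * HWs) * Fs / KF := by ring
  simp only [hR2] at ha₂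
  generalize (muD - fD) / (e * lamF * m) - Fs = P at *
  generalize (muD - fD) / (e * lamF * m * KF) - 2 * Fs / KF + (1 - α)
            + (β * HWs / KF) * P = B at *
  generalize rF * (1 + β * HWs) * Fs / KF = R at *
  generalize muD - fD = d at *
  have key : ∃ C₂ C₁ C₀ : ℝ, 0 < C₂ ∧ 0 < C₀
      ∧ (∀ ε : ℝ, 0 < ε →
          a₂ ε * a₁ ε - a₀ ε = C₂ / ε ^ 2 + C₁ / ε + C₀) := by
    refine ⟨(tmD + tmW) * ((tmD + tmW) * R + P * e * lamF * tmD),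
      (tmD + tmW) * d * R + (d + R) * ((tmD + tmW) * R + P * e * lamF * tmD)
        - e * lamF * tmD * rF * B * Fs, (d + R) * (d * R), by positivity, by positivity, ?_⟩
    intro ε hε
    rw [ha₂, ha₁, ha₀]
    field_simp
    ring
  obtain ⟨C₂, C₁, C₀, h2, h0, h⟩ := key
  refine ⟨⟨C₂, C₁, C₀, h2, h⟩, C₂ / (|C₁| + 1), by positivity, ?_⟩
  intro ε hε hlt
  rw [h ε hε]
  rw [lt_div_iff₀ (by positivity)] at hlt
  have h1 : 0 < C₂ + C₁ * ε := by nlinarith [neg_abs_le C₁]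
  have e1 : C₂ / ε ^ 2 + C₁ / ε + C₀ = (C₂ + C₁ * ε) / ε ^ 2 + C₀ := by
    field_simp
  rw [e1]
  positivity
end
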